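/- arXiv:2510.11312 — 3 statements merged into one kernel-verified Lean document; each statement's English description precedes it below -/
import Mathlib

section
/- Let f : ℝⁿ → ℝ be C² and (L₀, L₁)-smooth, i.e. ‖∇²f(x)‖ ≤ L₀ + L₁‖∇f(x)‖ for all x ∈ ℝⁿ, where ‖·‖ on matrices denotes the spectral norm. Then for all x, x̄ ∈ ℝⁿ: ‖ ∇f(x)/(L₀ + L₁‖∇f(x)‖) − ∇f(x̄)/(L₀ + L₁‖∇f(x̄)‖) ‖ ≤ ‖x − x̄‖. -/
noncomputable section

open Filter Topology Set

/-- The map `u ↦ u / (a + b‖u‖)` contracts distances between `u` and `w` by the geometric mean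
of its two scaling factors. -/
theorem norm_inv_smul_sub_inv_smul_le {F : Type*} [NormedAddCommGroup F] [InnerProductSpace ℝ F]
    {a b : ℝ} (ha : 0 < a) (hb : 0 ≤ b) (u w : F) :
    ‖(a + b * ‖u‖)⁻¹ • u - (a + b * ‖w‖)⁻¹ • w‖ ≤
      ‖u - w‖ / √((a + b * ‖u‖) * (a + b * ‖w‖)) := by
  have hs : 0 < a + b * ‖u‖ := by positivity
  have ht : 0 < a + b * ‖w‖ := by positivity
  rw [le_div_iff₀ (by positivity)]
  refine (sq_le_sq₀ (by positivity) (norm_nonneg _)).1 ?_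
  rw [mul_pow, Real.sq_sqrt (by positivity), norm_sub_sq_real, norm_sub_sq_real, norm_smul,
    norm_smul, real_inner_smul_left, real_inner_smul_right, Real.norm_of_nonneg (by positivity),
    Real.norm_of_nonneg (by positivity), ← sub_nonneg]
  have key : ‖u‖ ^ 2 - 2 * inner ℝ u w + ‖w‖ ^ 2 -
      (((a + b * ‖u‖)⁻¹ * ‖u‖) ^ 2 -
        2 * ((a + b * ‖u‖)⁻¹ * ((a + b * ‖w‖)⁻¹ * inner ℝ u w)) +
        ((a + b * ‖w‖)⁻¹ * ‖w‖) ^ 2) * ((a + b * ‖u‖) * (a + b * ‖w‖)) =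
      b * (‖u‖ - ‖w‖) ^ 2 * (a * (‖u‖ + ‖w‖) + b * ‖u‖ * ‖w‖) /
        ((a + b * ‖u‖) * (a + b * ‖w‖)) := by
    field_simp
    ring
  rw [key]
  positivity

/-- If the derivative of `G` is bounded by `a + b‖G‖`, then `G / (a + b‖G‖)` is nonexpansive. -/
theorem norm_inv_smul_sub_inv_smul_le_of_norm_fderiv_le {E F : Type*}
    [NormedAddCommGroup E] [NormedSpace ℝ E] [NormedAddCommGroup F] [InnerProductSpace ℝ F]
    {G : E → F} (hG : Differentiable ℝ G) {a b : ℝ} (ha : 0 < a) (hb : 0 ≤ b)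
    (bound : ∀ x, ‖fderiv ℝ G x‖ ≤ a + b * ‖G x‖) (x y : E) :
    ‖(a + b * ‖G x‖)⁻¹ • G x - (a + b * ‖G y‖)⁻¹ • G y‖ ≤ ‖x - y‖ := by
  set g : ℝ → F := fun t => G (y + t • (x - y)) with hg
  have hg' (t : ℝ) : HasDerivAt g (fderiv ℝ G (y + t • (x - y)) (x - y)) t := by
    have h : HasDerivAt (fun t : ℝ => y + t • (x - y)) (x - y) t := by
      simpa using ((hasDerivAt_id t).smul_const (x - y)).const_add y
    exact (hG _).hasFDerivAt.comp_hasDerivAt t h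
  have hgc : Continuous g := continuous_iff_continuousAt.2 fun t => (hg' t).continuousAt
  have hpos (t : ℝ) : 0 < a + b * ‖g t‖ := by positivity
  set h : ℝ → F := fun t => (a + b * ‖g t‖)⁻¹ • g t with hh
  have hhc : Continuous h :=
    ((continuous_const.add (continuous_const.mul hgc.norm)).inv₀ fun t => (hpos t).ne').smul hgc
  have main := image_le_of_liminf_slope_right_le_deriv_boundary (a := 0) (b := 1)
    (f := fun t => ‖h t - h 0‖) (B := fun t => t * ‖x - y‖) (B' := fun _ => ‖x - y‖)
    (hhc.sub continuous_const).norm.continuousOn (by simp) (by fun_prop)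
    (fun t _ => by simpa using ((hasDerivAt_id t).mul_const ‖x - y‖).hasDerivWithinAt)
    (fun t _ r hr => by
      have lim : Tendsto
          (fun z => ‖slope g t z‖ / √((a + b * ‖g z‖) * (a + b * ‖g t‖))) (𝓝[>] t)
          (𝓝 (‖fderiv ℝ G (y + t • (x - y)) (x - y)‖ /
            √((a + b * ‖g t‖) * (a + b * ‖g t‖)))) := by
        have hsl := (hasDerivAt_iff_tendsto_slope.1 (hg' t)).mono_left
          (nhdsWithin_mono t fun z (hz : t < z) => hz.ne')
        have hsq : Continuous fun z => √((a + b * ‖g z‖) * (a + b * ‖g t‖)) := by fun_prop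
        exact hsl.norm.div ((hsq.tendsto t).mono_left nhdsWithin_le_nhds)
          (Real.sqrt_pos.2 (mul_pos (hpos t) (hpos t))).ne'
      have hlt : ‖fderiv ℝ G (y + t • (x - y)) (x - y)‖ /
          √((a + b * ‖g t‖) * (a + b * ‖g t‖)) < r := by
        refine lt_of_le_of_lt ?_ hr
        rw [Real.sqrt_mul_self (hpos t).le, div_le_iff₀ (hpos t), mul_comm]
        exact ContinuousLinearMap.le_of_opNorm_le _ (bound _) _
      refine Eventually.frequently ?_
      filter_upwards [lim.eventually_lt_const hlt, self_mem_nhdsWithin] with z hz htz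
      refine lt_of_le_of_lt ?_ hz
      have htz' : 0 < z - t := sub_pos.2 htz
      rw [slope_def_module, slope_def_module, norm_smul, smul_eq_mul,
        Real.norm_of_nonneg (inv_nonneg.2 htz'.le), mul_div_assoc]
      gcongr
      calc ‖h z - h 0‖ - ‖h t - h 0‖ ≤ ‖h z - h t‖ := by
            simpa using norm_sub_norm_le (h z - h 0) (h t - h 0)
        _ ≤ _ := norm_inv_smul_sub_inv_smul_le ha hb _ _)
    (right_mem_Icc.2 zero_le_one)
  simpa [hh, hg] using main

/-- a `C²` function `f` that is `(L₀, L₁)`-smooth (i.e. the operator norm of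
its Hessian is bounded by `L₀ + L₁‖∇f(x)‖` everywhere) satisfies, for all `x, x̄`,
`‖∇f(x)/(L₀ + L₁‖∇f(x)‖) − ∇f(x̄)/(L₀ + L₁‖∇f(x̄)‖)‖ ≤ ‖x − x̄‖`. -/
theorem stmt_2 {n : ℕ} (f : EuclideanSpace ℝ (Fin n) → ℝ) (hf : ContDiff ℝ 2 f)
    (L₀ L₁ : ℝ) (hL₀ : 0 < L₀) (hL₁ : 0 < L₁)
    (hsmooth : ∀ x : EuclideanSpace ℝ (Fin n),
      ‖fderiv ℝ (gradient f) x‖ ≤ L₀ + L₁ * ‖gradient f x‖) :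
    ∀ x xb : EuclideanSpace ℝ (Fin n),
      ‖(L₀ + L₁ * ‖gradient f x‖)⁻¹ • gradient f x
        - (L₀ + L₁ * ‖gradient f xb‖)⁻¹ • gradient f xb‖ ≤ ‖x - xb‖ := by
  have hdiff : Differentiable ℝ (gradient f) :=
    (InnerProductSpace.toDual ℝ
        (EuclideanSpace ℝ (Fin n))).symm.toContinuousLinearEquiv.differentiable.comp
      ((hf.fderiv_right (m := 1) (by norm_num)).differentiable (by norm_num))
  exact norm_inv_smul_sub_inv_smul_le_of_norm_fderiv_le hdiff hL₀ hL₁.le hsmooth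

end
end

section
/- The function h₁ : ℝ → ℝ ∪ {+∞} defined by h₁(x) = −|x| − ln(1 − |x|) for |x| < 1 and h₁(x) = +∞ otherwise is 2-subhomogeneous: for all θ ∈ [0, 1] and all x with |x| < 1, h₁(θx) ≤ θ² h₁(x). -/
/-- Power series of `t ↦ -t - log (1 - t)` on `(-1, 1)`. -/
theorem hasSum_neg_sub_log_one_sub {t : ℝ} (ht : |t| < 1) :
    HasSum (fun n : ℕ => t ^ (n + 2) / ((n : ℝ) + 2)) (-t - Real.log (1 - t)) := by
  have h := (hasSum_nat_add_iff' 1).2 (Real.hasSum_pow_div_log_of_abs_lt_one ht)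
  have hsum : -Real.log (1 - t) - ∑ i ∈ Finset.range 1, t ^ (i + 1) / ((i : ℝ) + 1)
      = -t - Real.log (1 - t) := by
    simp only [Finset.sum_range_one, Nat.cast_zero]
    ring
  rw [hsum] at h
  have hterm : (fun n : ℕ => t ^ (n + 1 + 1) / (((n + 1 : ℕ) : ℝ) + 1))
      = fun n : ℕ => t ^ (n + 2) / ((n : ℝ) + 2) := by
    funext n
    push_cast
    ring
  rwa [hterm] at h

/-- the function `h₁(x) = −|x| − ln(1 − |x|)` (with domain `(−1,1)`) is
2-subhomogeneous: `h₁(θx) ≤ θ² h₁(x)` for all `θ ∈ [0,1]` and `|x| < 1`. -/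
theorem stmt_18 :
    ∀ θ ∈ Set.Icc (0 : ℝ) 1, ∀ x : ℝ, |x| < 1 →
      -|θ * x| - Real.log (1 - |θ * x|) ≤ θ ^ 2 * (-|x| - Real.log (1 - |x|)) := by
  rintro θ ⟨h0, h1⟩ x hx
  rw [abs_mul, abs_of_nonneg h0]
  have hθx : |θ * (|x|)| < 1 := by
    rw [abs_of_nonneg (by positivity)]
    exact (mul_le_of_le_one_left (abs_nonneg x) h1).trans_lt hx
  have hx' : |(|x|)| < 1 := by rwa [abs_abs]
  refine hasSum_le (fun n => ?_) (hasSum_neg_sub_log_one_sub hθx)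
    ((hasSum_neg_sub_log_one_sub hx').mul_left (θ ^ 2))
  rw [mul_pow, mul_div_assoc]
  gcongr ?_ * _
  exact pow_le_pow_of_le_one h0 h1 (Nat.le_add_left 2 n)
end

section
/- The function h₂ : ℝ → ℝ ∪ {+∞} defined by h₂(x) = 1 − √(1 − x²) for |x| ≤ 1 and h₂(x) = +∞ otherwise is 2-subhomogeneous: for all θ ∈ [0, 1] and all x with |x| ≤ 1, h₂(θx) ≤ θ² h₂(x). -/
/-- the function `h₂(x) = 1 − √(1 − x²)` (with domain `[−1,1]`) is
2-subhomogeneous: `h₂(θx) ≤ θ² h₂(x)` for all `θ ∈ [0,1]` and `|x| ≤ 1`. -/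
theorem stmt_19 :
    ∀ θ ∈ Set.Icc (0 : ℝ) 1, ∀ x : ℝ, |x| ≤ 1 →
      1 - Real.sqrt (1 - (θ * x) ^ 2) ≤ θ ^ 2 * (1 - Real.sqrt (1 - x ^ 2)) := by
  rintro θ ⟨hθ0, hθ1⟩ x hx
  have hx2 : x ^ 2 ≤ 1 := (sq_le_one_iff_abs_le_one x).2 hx
  have hθ2 : θ ^ 2 ≤ 1 := pow_le_one₀ hθ0 hθ1
  have hs : Real.sqrt (1 - x ^ 2) ^ 2 = 1 - x ^ 2 := Real.sq_sqrt (by linarith)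
  set s := Real.sqrt (1 - x ^ 2)
  have key : 1 - θ ^ 2 + θ ^ 2 * s ≤ Real.sqrt (1 - (θ * x) ^ 2) := by
    apply Real.le_sqrt_of_sq_le
    have hgap : 0 ≤ θ ^ 2 * (1 - θ ^ 2) * (1 - s) ^ 2 :=
      mul_nonneg (mul_nonneg (sq_nonneg θ) (by linarith)) (sq_nonneg _)
    have hx_eq : x ^ 2 = 1 - s ^ 2 := by linarith
    rw [mul_pow, hx_eq]
    linarith
  linarith
end
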